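/- Any centered Gaussian process F on [0,∞) with covariance function ρ has a modification which is locally Hölder continuous on [0,∞) with exponent γ for every γ < 1/4. -/

import Mathlib

open MeasureTheory Real Set Filter

/-- The Gaussian heat kernel `p(t,x,y) = (2πt)^{-1/2} exp(-(x-y)²/(2t))`. -/
noncomputable def heatKernel (t x y : ℝ) : ℝ :=
  (Real.sqrt (2 * Real.pi * t))⁻¹ * Real.exp (-(x - y) ^ 2 / (2 * t))

/-- The density `u(x,t)` of `B(t)`: `f` evolved by the heat semigroup. -/
noncomputable def udens (f : ℝ → ℝ) (x t : ℝ) : ℝ :=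
  if t = 0 then f x else ∫ y : ℝ, heatKernel t x y * f y

/-- The covariance function
`ρ(s,t) = (P(B(s) ≤ q(s), B(t) ≤ q(t)) − α²)/(u(q(s),s) u(q(t),t))`. -/
noncomputable def rho {Ω : Type*} [MeasurableSpace Ω] (P : Measure Ω)
    (B : ℝ → Ω → ℝ) (f : ℝ → ℝ) (q : ℝ → ℝ) (α s t : ℝ) : ℝ :=
  ((P {ω | B s ω ≤ q s ∧ B t ω ≤ q t}).toReal - α ^ 2) /
    (udens f (q s) s * udens f (q t) t)

section

open scoped NNReal ENNReal Topology
open ProbabilityTheory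

lemma heatKernel_eq_gaussianPDFReal {t : ℝ} (ht : 0 ≤ t) (x y : ℝ) :
    heatKernel t x y = gaussianPDFReal x t.toNNReal y := by
  rw [heatKernel, gaussianPDFReal, Real.coe_toNNReal t ht, ← neg_sub y x, neg_sq]

lemma map_gaussianReal_affine (x : ℝ) {t : ℝ} (ht : 0 ≤ t) :
    (gaussianReal 0 1).map (fun z => x + √t * z) = gaussianReal x t.toNNReal := by
  have h := Measure.map_map (μ := gaussianReal 0 1) (measurable_const_add x)
    (measurable_const_mul (√t))
  rw [gaussianReal_map_const_mul, gaussianReal_map_const_add] at h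
  rw [show (fun z => x + √t * z) = (x + ·) ∘ (√t * ·) from rfl, ← h]
  congr 1
  · ring
  · ext
    simp [Real.sq_sqrt ht, Real.coe_toNNReal t ht]

lemma udens_eq_integral_gaussianReal {f : ℝ → ℝ} (hf : Continuous f) (x : ℝ) {t : ℝ}
    (ht : 0 ≤ t) : udens f x t = ∫ z, f (x + √t * z) ∂(gaussianReal 0 1) := by
  rcases ht.eq_or_lt with rfl | ht'
  · simp [udens]
  have h0 : t.toNNReal ≠ 0 := by simpa using ht'
  rw [udens, if_neg ht'.ne']
  calc ∫ y, heatKernel t x y * f y = ∫ y, f y ∂(gaussianReal x t.toNNReal) := by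
        rw [integral_gaussianReal_eq_integral_smul h0]
        simp [heatKernel_eq_gaussianPDFReal ht]
    _ = _ := by
        rw [← map_gaussianReal_affine x ht, integral_map (by fun_prop) hf.aestronglyMeasurable]

lemma integral_abs_gaussianReal_le_one : ∫ z, |z| ∂(gaussianReal 0 1) ≤ 1 := by
  have h2 : MemLp id 2 (gaussianReal 0 1) := memLp_id_gaussianReal 2
  have hi : Integrable (fun z : ℝ => z ^ 2) (gaussianReal 0 1) := h2.integrable_sq
  have hv : ∫ z : ℝ, z ^ 2 ∂(gaussianReal 0 1) = 1 := by
    have := variance_id_gaussianReal (μ := 0) (v := 1)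
    rw [variance_eq_sub h2] at this
    simpa using this
  calc ∫ z, |z| ∂(gaussianReal 0 1) ≤ ∫ z : ℝ, (1 + z ^ 2) / 2 ∂(gaussianReal 0 1) := by
        refine integral_mono (h2.integrable (by norm_num)).abs
          (((integrable_const 1).add hi).div_const 2) fun z => ?_
        have := two_mul_le_add_sq 1 |z|
        rw [sq_abs] at this
        simp only
        linarith
    _ = 1 := by
        rw [integral_div, integral_add (integrable_const 1) hi, hv]
        simp

lemma integrable_comp_gaussianReal {f : ℝ → ℝ} (hf : Continuous f) {M : ℝ}
    (hM : ∀ x, |f x| ≤ M) (a b : ℝ) :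
    Integrable (fun z => f (a + b * z)) (gaussianReal 0 1) :=
  Integrable.of_bound (by fun_prop) M (Eventually.of_forall fun z => hM _)

lemma udens_nonneg {f : ℝ → ℝ} (hf0 : ∀ x, 0 ≤ f x) (x t : ℝ) : 0 ≤ udens f x t := by
  rw [udens]
  split_ifs
  · exact hf0 x
  · exact integral_nonneg fun y => mul_nonneg
      (mul_nonneg (inv_nonneg.2 (sqrt_nonneg _)) (exp_pos _).le) (hf0 y)

lemma udens_le {f : ℝ → ℝ} (hf : Continuous f) {M : ℝ} (hM : ∀ x, |f x| ≤ M) (x : ℝ) {t : ℝ}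
    (ht : 0 ≤ t) : udens f x t ≤ M := by
  rw [udens_eq_integral_gaussianReal hf x ht]
  calc _ ≤ ∫ _, M ∂(gaussianReal 0 1) := integral_mono (integrable_comp_gaussianReal hf hM _ _)
        (integrable_const _) fun z => (le_abs_self _).trans (hM _)
    _ = M := by simp

lemma udens_pos {f : ℝ → ℝ} (hf : Continuous f) (hf0 : ∀ x, 0 ≤ f x) {M : ℝ}
    (hM : ∀ x, |f x| ≤ M) (hne : ∃ x, f x ≠ 0) (x : ℝ) {t : ℝ} (ht : 0 < t) :
    0 < udens f x t := by
  have hs : 0 < √t := sqrt_pos.2 ht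
  rw [udens_eq_integral_gaussianReal hf x ht.le, integral_pos_iff_support_of_nonneg
    (fun z => hf0 _) (integrable_comp_gaussianReal hf hM _ _)]
  have ho : IsOpen (Function.support fun z => f (x + √t * z)) :=
    (hf.comp (by fun_prop)).isOpen_support
  obtain ⟨y, hy⟩ := hne
  have hn : (Function.support fun z => f (x + √t * z)).Nonempty := by
    refine ⟨(y - x) / √t, ?_⟩
    rw [Function.mem_support, mul_div_cancel₀ _ hs.ne']
    simpa using hy
  rw [pos_iff_ne_zero]
  intro h0
  exact (ho.measure_pos volume hn).ne' (gaussianReal_absolutelyContinuous' 0 one_ne_zero h0)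

lemma abs_udens_sub_le {f : ℝ → ℝ} (hf : Continuous f) {M L : ℝ} (hM : ∀ x, |f x| ≤ M)
    (hL0 : 0 ≤ L) (hL : ∀ x y, |f x - f y| ≤ L * |x - y|) (x y : ℝ) {s t : ℝ} (hs : 0 ≤ s)
    (ht : 0 ≤ t) :
    |udens f x s - udens f y t| ≤ L * (|x - y| + √|s - t|) := by
  have hz : Integrable (fun z : ℝ => |z|) (gaussianReal 0 1) :=
    ((memLp_id_gaussianReal (μ := 0) (v := 1) 1).integrable (by norm_num)).abs
  have hst : |√s - √t| ≤ √|s - t| := by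
    wlog h : t ≤ s generalizing s t
    · rw [abs_sub_comm, abs_sub_comm s]
      exact this ht hs (le_of_not_ge h)
    rw [abs_of_nonneg (sub_nonneg.2 (sqrt_le_sqrt h)), abs_of_nonneg (sub_nonneg.2 h)]
    have hr : √s ≤ √(s - t) + √t := by
      refine Real.sqrt_le_iff.2 ⟨by positivity, ?_⟩
      nlinarith [Real.sq_sqrt ht, Real.sq_sqrt (sub_nonneg.2 h),
        mul_nonneg (sqrt_nonneg (s - t)) (sqrt_nonneg t)]
    linarith
  rw [udens_eq_integral_gaussianReal hf x hs, udens_eq_integral_gaussianReal hf y ht,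
    ← integral_sub (integrable_comp_gaussianReal hf hM _ _)
      (integrable_comp_gaussianReal hf hM _ _)]
  calc _ ≤ ∫ z, |f (x + √s * z) - f (y + √t * z)| ∂(gaussianReal 0 1) :=
        abs_integral_le_integral_abs
    _ ≤ ∫ z, L * (|x - y| + √|s - t| * |z|) ∂(gaussianReal 0 1) := by
        refine integral_mono (((integrable_comp_gaussianReal hf hM _ _).sub
          (integrable_comp_gaussianReal hf hM _ _)).abs)
          (((integrable_const _).add (hz.const_mul _)).const_mul _) fun z => ?_
        refine (hL _ _).trans (mul_le_mul_of_nonneg_left ?_ hL0)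
        calc |x + √s * z - (y + √t * z)| = |(x - y) + (√s - √t) * z| := by ring_nf
          _ ≤ |x - y| + |√s - √t| * |z| := by rw [← abs_mul]; exact abs_add_le _ _
          _ ≤ _ := by gcongr
    _ = L * (|x - y| + √|s - t| * ∫ z, |z| ∂(gaussianReal 0 1)) := by
        rw [integral_const_mul, integral_add (integrable_const _) (hz.const_mul _),
          integral_const_mul]
        simp
    _ ≤ _ := by
        gcongr
        exact mul_le_of_le_one_right (sqrt_nonneg _) integral_abs_gaussianReal_le_one

lemma gaussianReal_real_Ioi_le {x b : ℝ} {v : ℝ≥0} (hv : v ≠ 0) (h : x ≤ b) :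
    (gaussianReal x v).real (Ioi b) ≤ exp (-(b - x) ^ 2 / (2 * v)) := by
  have hv' : (v : ℝ) ≠ 0 := by exact_mod_cast hv
  have h1 := measure_ge_le_exp_mul_mgf (X := id) (μ := gaussianReal x v) (t := (b - x) / v) b
    (div_nonneg (sub_nonneg.2 h) v.2) (integrable_exp_mul_gaussianReal _)
  rw [mgf_id_gaussianReal, ← exp_add] at h1
  refine (measureReal_mono (s₂ := {y | b ≤ id y}) fun y hy => le_of_lt (mem_Ioi.1 hy)).trans
    (h1.trans_eq ?_)
  congr 1
  field_simp
  ring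

lemma gaussianReal_real_Iic_le {x b : ℝ} {v : ℝ≥0} (hv : v ≠ 0) (h : b ≤ x) :
    (gaussianReal x v).real (Iic b) ≤ exp (-(b - x) ^ 2 / (2 * v)) := by
  have hv' : (v : ℝ) ≠ 0 := by exact_mod_cast hv
  have h1 := measure_le_le_exp_mul_mgf (X := id) (μ := gaussianReal x v) (t := (b - x) / v) b
    (div_nonpos_of_nonpos_of_nonneg (sub_nonpos.2 h) v.2) (integrable_exp_mul_gaussianReal _)
  rw [mgf_id_gaussianReal, ← exp_add] at h1
  refine h1.trans_eq ?_
  congr 1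
  field_simp
  ring

lemma setIntegral_heatKernel {t : ℝ} (ht : 0 < t) (x b : ℝ) :
    ∫ y in Iic b, heatKernel t x y = (gaussianReal x t.toNNReal).real (Iic b) := by
  have h0 : t.toNNReal ≠ 0 := by simpa using ht
  rw [measureReal_def, gaussianReal_apply_eq_integral x h0, ENNReal.toReal_ofReal
    (integral_nonneg fun y => gaussianPDFReal_nonneg _ _ _)]
  simp [heatKernel_eq_gaussianPDFReal ht.le]

lemma measurable_setIntegral_heatKernel (t b : ℝ) :
    Measurable fun x => ∫ y in Iic b, heatKernel t x y := by
  have h : StronglyMeasurable (Function.uncurry (heatKernel t)) := by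
    refine Measurable.stronglyMeasurable ?_
    unfold Function.uncurry heatKernel
    fun_prop
  exact h.integral_prod_right.measurable

lemma one_sub_setIntegral_heatKernel_le {t : ℝ} (ht : 0 < t) {x b : ℝ} (h : x ≤ b) :
    1 - ∫ y in Iic b, heatKernel t x y ≤ exp (-(1 / (2 * t)) * (x - b) ^ 2) := by
  have h0 : t.toNNReal ≠ 0 := by simpa using ht
  rw [setIntegral_heatKernel ht, ← probReal_compl_eq_one_sub measurableSet_Iic, compl_Iic]
  refine (gaussianReal_real_Ioi_le h0 h).trans_eq ?_
  rw [Real.coe_toNNReal t ht.le]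
  congr 1
  field_simp
  ring

lemma setIntegral_heatKernel_le {t : ℝ} (ht : 0 < t) {x b : ℝ} (h : b ≤ x) :
    ∫ y in Iic b, heatKernel t x y ≤ exp (-(1 / (2 * t)) * (x - b) ^ 2) := by
  have h0 : t.toNNReal ≠ 0 := by simpa using ht
  rw [setIntegral_heatKernel ht]
  refine (gaussianReal_real_Iic_le h0 h).trans_eq ?_
  rw [Real.coe_toNNReal t ht.le]
  congr 1
  field_simp
  ring

lemma setIntegral_heatKernel_mem_Icc {t : ℝ} (ht : 0 < t) (x b : ℝ) :
    ∫ y in Iic b, heatKernel t x y ∈ Icc (0 : ℝ) 1 := by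
  rw [setIntegral_heatKernel ht]
  exact ⟨measureReal_nonneg, measureReal_le_one⟩

lemma setIntegral_le_mul_sqrt_of_le_gaussian {t M a : ℝ} (ht : 0 < t) (hM : 0 ≤ M) {S : Set ℝ}
    (hS : MeasurableSet S) {g : ℝ → ℝ}
    (hg : ∀ x ∈ S, g x ≤ M * exp (-(1 / (2 * t)) * (x - a) ^ 2)) :
    ∫ x in S, g x ≤ M * √(2 * π * t) := by
  have hb : 0 < 1 / (2 * t) := by positivity
  have hi : Integrable fun x : ℝ => M * exp (-(1 / (2 * t)) * (x - a) ^ 2) :=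
    ((integrable_exp_neg_mul_sq hb).comp_sub_right a).const_mul M
  by_cases hgi : IntegrableOn g S
  · calc ∫ x in S, g x ≤ ∫ x in S, M * exp (-(1 / (2 * t)) * (x - a) ^ 2) :=
        setIntegral_mono_on hgi hi.integrableOn hS hg
      _ ≤ ∫ x, M * exp (-(1 / (2 * t)) * (x - a) ^ 2) :=
        setIntegral_le_integral hi (Eventually.of_forall fun x => by positivity)
      _ = M * √(2 * π * t) := by
        rw [integral_const_mul,
          integral_sub_right_eq_self (fun x => exp (-(1 / (2 * t)) * x ^ 2)) a,
          integral_gaussian]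
        congr 2
        field_simp
  · rw [integral_undef hgi]
    positivity

/-- If the law of `(X, Y)` has density `u` in the first coordinate and a Gaussian transition kernel
of variance `t` from `X` to `Y`, then the probability that exactly one of `X`, `Y` lies below a
level `a` is `O(√t)`. -/
lemma crossing_le {Ω : Type*} [MeasurableSpace Ω] {P : Measure Ω} [IsProbabilityMeasure P]
    {X Y : Ω → ℝ} {u : ℝ → ℝ} {M t : ℝ} (ht : 0 < t) (hu0 : ∀ x, 0 ≤ u x)
    (huM : ∀ x, u x ≤ M) (hui : ∀ a, IntegrableOn u (Iic a))
    (hX : ∀ a : ℝ, P.real {ω | X ω ≤ a} = ∫ x in Iic a, u x)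
    (hXY : ∀ a b : ℝ, P.real {ω | X ω ≤ a ∧ Y ω ≤ b} =
      ∫ x in Iic a, (∫ y in Iic b, heatKernel t x y) * u x) (a : ℝ) :
    P.real {ω | X ω ≤ a} - P.real {ω | X ω ≤ a ∧ Y ω ≤ a} ≤ M * √(2 * π * t) ∧
    P.real {ω | Y ω ≤ a} - P.real {ω | X ω ≤ a ∧ Y ω ≤ a} ≤ M * √(2 * π * t) := by
  have hM : 0 ≤ M := (hu0 0).trans (huM 0)
  have hki : ∀ c, IntegrableOn (fun x => (∫ y in Iic a, heatKernel t x y) * u x) (Iic c) :=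
    fun c => (hui c).bdd_mul (c := 1) (measurable_setIntegral_heatKernel t a).aestronglyMeasurable
      (Eventually.of_forall fun x => by
        have := setIntegral_heatKernel_mem_Icc ht x a
        rw [Real.norm_of_nonneg this.1]
        exact this.2)
  constructor
  · rw [hX, hXY, ← integral_sub (hui a) (hki a)]
    refine setIntegral_le_mul_sqrt_of_le_gaussian (a := a) ht hM measurableSet_Iic fun x hx => ?_
    have h1 := one_sub_setIntegral_heatKernel_le ht (mem_Iic.1 hx)
    have h2 := (setIntegral_heatKernel_mem_Icc ht x a).2
    calc _ = u x * (1 - ∫ y in Iic a, heatKernel t x y) := by ring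
      _ ≤ M * _ := mul_le_mul (huM x) h1 (sub_nonneg.2 h2) hM
  · have hlim : Tendsto (fun n : ℕ => P.real {ω | X ω ≤ n ∧ Y ω ≤ a}) atTop
        (𝓝 (P.real {ω | Y ω ≤ a})) := by
      have hU : ⋃ n : ℕ, {ω | X ω ≤ n ∧ Y ω ≤ a} = {ω | Y ω ≤ a} := by
        ext ω
        simp only [mem_iUnion, mem_ofPred_eq, exists_and_right, and_iff_right_iff_imp]
        exact fun _ => exists_nat_ge (X ω)
      rw [← hU]
      refine (ENNReal.tendsto_toReal (measure_ne_top _ _)).comp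
        (tendsto_measure_iUnion_atTop fun m n hmn ω hω => ⟨hω.1.trans ?_, hω.2⟩)
      exact_mod_cast hmn
    refine le_of_tendsto (hlim.sub_const _) ?_
    filter_upwards [eventually_ge_atTop ⌈a⌉₊] with n hn
    have han : a ≤ n := Nat.ceil_le.1 hn
    rw [hXY, hXY, ← Iic_union_Ioc_eq_Iic han,
      setIntegral_union (Iic_disjoint_Ioc le_rfl) measurableSet_Ioc (hki a)
        ((hki n).mono_set Ioc_subset_Iic_self), add_sub_cancel_left]
    refine setIntegral_le_mul_sqrt_of_le_gaussian (a := a) ht hM measurableSet_Ioc fun x hx => ?_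
    rw [mul_comm]
    exact mul_le_mul (huM x) (setIntegral_heatKernel_le ht hx.1.le)
      (setIntegral_heatKernel_mem_Icc ht x a).1 hM

lemma mul_le_abs_setIntegral_Iic_sub {v : ℝ → ℝ} {a b c L r : ℝ} (hv0 : ∀ x, 0 ≤ v x)
    (hvi : ∀ x, IntegrableOn v (Iic x)) (hL : 0 ≤ L) (hv : ∀ x, c - L * |x - a| ≤ v x)
    (hr0 : 0 ≤ r) (hr : r ≤ |b - a|) :
    r * (c - L * r) ≤ |(∫ x in Iic b, v x) - ∫ x in Iic a, v x| := by
  have key : ∀ l m l' m' : ℝ, l ≤ l' → m' ≤ m → l' ≤ m' → m' - l' = r →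
      (∀ x ∈ Ioc l' m', |x - a| ≤ r) →
      r * (c - L * r) ≤ (∫ x in Iic m, v x) - ∫ x in Iic l, v x := by
    intro l m l' m' h1 h2 h3 h4 h5
    rw [← Iic_union_Ioc_eq_Iic (h1.trans (h3.trans h2)),
      setIntegral_union (Iic_disjoint_Ioc le_rfl) measurableSet_Ioc (hvi l)
        ((hvi m).mono_set Ioc_subset_Iic_self), add_sub_cancel_left]
    calc r * (c - L * r) = ∫ x in Ioc l' m', (c - L * r) := by
          simp [h4, hr0]
      _ ≤ ∫ x in Ioc l' m', v x := by
          refine setIntegral_mono_on (by simp)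
            ((hvi m').mono_set Ioc_subset_Iic_self) measurableSet_Ioc fun x hx => ?_
          have := mul_le_mul_of_nonneg_left (h5 x hx) hL
          linarith [hv x]
      _ ≤ ∫ x in Ioc l m, v x := by
          refine setIntegral_mono_set ((hvi m).mono_set Ioc_subset_Iic_self)
            (Eventually.of_forall hv0) (Ioc_subset_Ioc h1 h2).eventuallyLE
  rcases le_total a b with h | h
  · rw [abs_of_nonneg (sub_nonneg.2 h)] at hr
    refine (key a b a (a + r) le_rfl (by linarith) (by linarith) (by ring) ?_).trans
      (le_abs_self _)
    intro x hx
    rw [abs_of_nonneg (by linarith [hx.1])]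
    linarith [hx.2]
  · rw [abs_sub_comm, abs_of_nonneg (sub_nonneg.2 h)] at hr
    rw [abs_sub_comm]
    refine (key b a (a - r) a (by linarith) le_rfl (by linarith) (by ring) ?_).trans
      (le_abs_self _)
    intro x hx
    rw [abs_of_nonpos (by linarith [hx.2])]
    linarith [hx.1]

lemma tendsto_sqrt_abs_sub (s : ℝ) (S : Set ℝ) :
    Tendsto (fun t => √|s - t|) (𝓝[S] s) (𝓝 0) := by
  have h : Continuous fun t => √|s - t| := by fun_prop
  simpa using (h.tendsto s).mono_left nhdsWithin_le_nhds

/-- A quantile path `q` whose increments are controlled through the density `g` along the path is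
continuous. -/
lemma continuousOn_of_quantile_bound {q g : ℝ → ℝ} {L K : ℝ} (hL : 0 < L)
    (hg : ∀ t, 0 ≤ t → 0 < g t)
    (hq : ∀ s t, 0 ≤ s → 0 ≤ t → ∀ r, 0 ≤ r → r ≤ |q t - q s| →
      r * (g s - L * √|s - t| - L * r) ≤ K * √|s - t|) :
    ContinuousOn q (Ici 0) := by
  intro s hs
  rw [ContinuousWithinAt, Metric.tendsto_nhds]
  intro ε hε
  have hgs := hg s hs
  set r := min ε (g s / (2 * L)) with hr
  have hr0 : 0 < r := lt_min hε (by positivity)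
  have hrL : L * r ≤ g s / 2 := by
    calc L * r ≤ L * (g s / (2 * L)) := by gcongr; exact min_le_right _ _
      _ = g s / 2 := by field_simp
  have hw := tendsto_sqrt_abs_sub s (Ici 0)
  have hlim : Tendsto (fun t => r * (g s - L * √|s - t| - L * r) - K * √|s - t|) (𝓝[Ici 0] s)
      (𝓝 (r * (g s - L * 0 - L * r) - K * 0)) :=
    ((((tendsto_const_nhds.sub (hw.const_mul L)).sub_const _).const_mul r)).sub (hw.const_mul K)
  have hpos : 0 < r * (g s - L * 0 - L * r) - K * 0 := by
    have : 0 < g s - L * 0 - L * r := by linarith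
    simpa using mul_pos hr0 this
  filter_upwards [hlim.eventually_const_lt hpos, self_mem_nhdsWithin] with t ht ht0
  by_contra hcon
  rw [Real.dist_eq, not_lt] at hcon
  linarith [hq s t hs ht0 r hr0.le ((min_le_left _ _).trans hcon)]

lemma continuousOn_of_abs_sub_le {q g : ℝ → ℝ} {L : ℝ} (hq : ContinuousOn q (Ici 0))
    (hgq : ∀ s t, 0 ≤ s → 0 ≤ t → |g s - g t| ≤ L * (|q s - q t| + √|s - t|)) :
    ContinuousOn g (Ici 0) := by
  intro s hs
  rw [ContinuousWithinAt, tendsto_iff_dist_tendsto_zero]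
  have hlim : Tendsto (fun t => L * (|q s - q t| + √|s - t|)) (𝓝[Ici 0] s) (𝓝 0) := by
    have := ((tendsto_const_nhds.sub (hq s hs)).abs.add
      (tendsto_sqrt_abs_sub s (Ici 0))).const_mul L (x := 𝓝[Ici 0] s)
        (f := fun t => |q s - q t| + √|s - t|)
    simpa using this
  refine squeeze_zero' (Eventually.of_forall fun t => dist_nonneg) ?_ hlim
  filter_upwards [self_mem_nhdsWithin] with t ht
  rw [dist_comm, Real.dist_eq]
  exact hgq s t hs ht

lemma abs_sub_le_of_quantile_bound {d c L K w g : ℝ} (hL : 0 < L) (hK : 0 < K) (hc : 0 < c)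
    (hcg : c ≤ g) (hd : 0 ≤ d) (hw1 : w ≤ c / (4 * L)) (hw2 : w < c ^ 2 / (8 * L * K))
    (h : ∀ r, 0 ≤ r → r ≤ d → r * (g - L * w - L * r) ≤ K * w) : d ≤ 2 * K / c * w := by
  set r := min d (c / (4 * L)) with hr
  have hr0 : 0 ≤ r := le_min hd (by positivity)
  have h1 := h r hr0 (min_le_left _ _)
  have hLw : L * w ≤ c / 4 := by
    calc L * w ≤ L * (c / (4 * L)) := by gcongr
      _ = c / 4 := by field_simp
  have hLr : L * r ≤ c / 4 := by
    calc L * r ≤ L * (c / (4 * L)) := by gcongr; exact min_le_right _ _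
      _ = c / 4 := by field_simp
  have h2 : r * (c / 2) ≤ K * w := by
    refine le_trans (mul_le_mul_of_nonneg_left ?_ hr0) h1
    linarith
  have h3 : K * w < c ^ 2 / (8 * L) := by
    calc K * w < K * (c ^ 2 / (8 * L * K)) := by gcongr
      _ = _ := by field_simp
  have h4 : r < c / (4 * L) := by
    by_contra hcon
    have : c / (4 * L) * (c / 2) ≤ r * (c / 2) := by gcongr; exact not_lt.1 hcon
    have h5 : c / (4 * L) * (c / 2) = c ^ 2 / (8 * L) := by field_simp; norm_num
    linarith
  have h6 : r = d := by
    rcases min_choice d (c / (4 * L)) with h' | h'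
    · exact h'
    · rw [← hr] at h'
      exact absurd h' h4.ne
  rw [h6] at h2
  rw [div_mul_eq_mul_div, le_div_iff₀ hc]
  linarith

lemma exists_holder_of_quantile_bound {q g : ℝ → ℝ} {L K M : ℝ} (hL : 0 < L) (hK : 0 < K)
    (hg : ∀ t, 0 ≤ t → 0 < g t) (hgM : ∀ t, 0 ≤ t → g t ≤ M)
    (hq : ∀ s t, 0 ≤ s → 0 ≤ t → ∀ r, 0 ≤ r → r ≤ |q t - q s| →
      r * (g s - L * √|s - t| - L * r) ≤ K * √|s - t|)
    (hgq : ∀ s t, 0 ≤ s → 0 ≤ t → |g s - g t| ≤ L * (|q s - q t| + √|s - t|))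
    {T : ℝ} (hT : 0 ≤ T) :
    ∃ c C : ℝ, 0 < c ∧ 0 ≤ C ∧ (∀ t ∈ Icc 0 T, c ≤ g t) ∧
      ∀ s ∈ Icc 0 T, ∀ t ∈ Icc 0 T, |g s - g t| ≤ C * √|s - t| := by
  have hgc : ContinuousOn g (Icc 0 T) :=
    (continuousOn_of_abs_sub_le (continuousOn_of_quantile_bound hL hg hq) hgq).mono
      Icc_subset_Ici_self
  obtain ⟨t₀, ht₀, hmin⟩ := isCompact_Icc.exists_isMinOn (nonempty_Icc.2 hT) hgc
  set c := g t₀ with hcdef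
  have hc : 0 < c := hg t₀ ht₀.1
  have hM : 0 < M := hc.trans_le (hgM t₀ ht₀.1)
  set η := min (c / (4 * L)) (c ^ 2 / (8 * L * K)) with hη
  have hη0 : 0 < η := lt_min (by positivity) (by positivity)
  refine ⟨c, L * (2 * K / c + 1) + M / η, hc, by positivity, fun t ht => hmin ht, ?_⟩
  intro s hs t ht
  have hw0 : 0 ≤ √|s - t| := sqrt_nonneg _
  rcases lt_or_ge (√|s - t|) η with hw | hw
  · have hd := abs_sub_le_of_quantile_bound hL hK hc (hmin hs) (abs_nonneg (q t - q s))
      (hw.le.trans (min_le_left _ _)) (hw.trans_le (min_le_right _ _)) (hq s t hs.1 ht.1)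
    rw [abs_sub_comm] at hd
    calc |g s - g t| ≤ L * (|q s - q t| + √|s - t|) := hgq s t hs.1 ht.1
      _ ≤ L * (2 * K / c * √|s - t| + √|s - t|) := by gcongr
      _ = L * (2 * K / c + 1) * √|s - t| := by ring
      _ ≤ _ := by gcongr; exact le_add_of_nonneg_right (by positivity)
  · calc |g s - g t| ≤ M := abs_sub_le_of_nonneg_of_le (hg s hs.1).le (hgM s hs.1)
          (hg t ht.1).le (hgM t ht.1)
      _ = M / η * η := by field_simp
      _ ≤ M / η * √|s - t| := by gcongr
      _ ≤ _ := by gcongr; exact le_add_of_nonneg_left (by positivity)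

lemma increment_variance_le {α p a b c C K w W : ℝ} (hα : α ∈ Ioo (0 : ℝ) 1) (hc : 0 < c)
    (ha : c ≤ a) (hb : c ≤ b) (hK : 0 ≤ K) (hp : α - p ≤ K * w) (hab : |a - b| ≤ C * w)
    (hw0 : 0 ≤ w) (hwW : w ≤ W) :
    (α - α ^ 2) / (a * a) + (α - α ^ 2) / (b * b) - 2 * ((p - α ^ 2) / (a * b)) ≤
      (C ^ 2 * W / c ^ 4 + 2 * K / c ^ 2) * w := by
  have ha0 : 0 < a := hc.trans_le ha
  have hb0 : 0 < b := hc.trans_le hb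
  have hcab : c ^ 2 ≤ a * b := by rw [sq]; exact mul_le_mul ha hb hc.le ha0.le
  have h1 : (α - α ^ 2) / (a * a) + (α - α ^ 2) / (b * b) - 2 * ((p - α ^ 2) / (a * b)) =
      (α * (1 - α)) * (a - b) ^ 2 / (a * b) ^ 2 + 2 * (α - p) / (a * b) := by
    field_simp
    ring
  have h2 : (α * (1 - α)) * (a - b) ^ 2 / (a * b) ^ 2 ≤ C ^ 2 * W / c ^ 4 * w := by
    have h3 : (a - b) ^ 2 ≤ (C * w) ^ 2 := sq_le_sq' (abs_le.1 hab).1 (abs_le.1 hab).2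
    have h4 : α * (1 - α) ≤ 1 := by nlinarith [hα.1, hα.2]
    calc (α * (1 - α)) * (a - b) ^ 2 / (a * b) ^ 2 ≤ 1 * (C * w) ^ 2 / (c ^ 2) ^ 2 := by gcongr
      _ = C ^ 2 * w / c ^ 4 * w := by ring
      _ ≤ _ := by gcongr
  have h5 : 2 * (α - p) / (a * b) ≤ 2 * K / c ^ 2 * w := by
    calc 2 * (α - p) / (a * b) ≤ 2 * (K * w) / (a * b) := by gcongr
      _ ≤ 2 * (K * w) / c ^ 2 := by gcongr
      _ = _ := by ring
  rw [h1, add_mul]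
  exact add_le_add h2 h5

/-- The left endpoint of the dyadic interval of order `n` containing `t`. -/
noncomputable def dyadicFloor (n : ℕ) (t : ℝ) : ℝ := (⌊2 ^ n * t⌋₊ : ℝ) / 2 ^ n

/-- Hölder-type bounds at all dyadic scales on increments over neighbouring dyadic points of
`[0, N]`. -/
def DyadicIncrementBound (x : ℝ → ℝ) (γ : ℝ) (N : ℕ) : Prop :=
  ∃ K : ℝ, 0 ≤ K ∧ ∀ n k : ℕ, k < N * 2 ^ n →
    |x ((k + 1 : ℕ) / 2 ^ n) - x (k / 2 ^ n)| ≤ K * ((2 : ℝ) ^ (-γ)) ^ n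

lemma DyadicIncrementBound.mono {x : ℝ → ℝ} {γ γ' : ℝ} {N : ℕ}
    (h : DyadicIncrementBound x γ' N) (hγ : γ ≤ γ') : DyadicIncrementBound x γ N := by
  obtain ⟨K, hK, h⟩ := h
  refine ⟨K, hK, fun n k hk => (h n k hk).trans ?_⟩
  have : (2 : ℝ) ^ (-γ') ≤ 2 ^ (-γ) := rpow_le_rpow_of_exponent_le one_le_two (neg_le_neg hγ)
  gcongr

lemma dyadicFloor_mem_Icc {N : ℕ} (n : ℕ) {t : ℝ} (ht : t ∈ Icc (0 : ℝ) N) :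
    dyadicFloor n t ∈ Icc (0 : ℝ) N := by
  have h2 : (0 : ℝ) < 2 ^ n := by positivity
  refine ⟨by unfold dyadicFloor; positivity, ?_⟩
  rw [dyadicFloor, div_le_iff₀ h2, mul_comm (N : ℝ)]
  exact (Nat.floor_le (mul_nonneg h2.le ht.1)).trans (mul_le_mul_of_nonneg_left ht.2 h2.le)

lemma abs_sub_dyadicFloor_le (n : ℕ) {t : ℝ} (ht : 0 ≤ t) :
    |t - dyadicFloor n t| ≤ (1 / 2) ^ n := by
  have h2 : (0 : ℝ) < 2 ^ n := by positivity
  have h1 := Nat.floor_le (mul_nonneg h2.le ht)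
  have h3 := (Nat.lt_floor_add_one (2 ^ n * t)).le
  have h4 : t - dyadicFloor n t = (2 ^ n * t - ⌊2 ^ n * t⌋₊) / 2 ^ n := by
    rw [dyadicFloor]
    field_simp
  rw [h4, abs_of_nonneg (div_nonneg (by linarith) h2.le), one_div_pow]
  gcongr
  linarith

lemma floor_le_mul_two_pow {N : ℕ} (n : ℕ) {t : ℝ} (ht : t ≤ N) :
    ⌊2 ^ n * t⌋₊ ≤ N * 2 ^ n := by
  have h : (2 : ℝ) ^ n * t ≤ (N * 2 ^ n : ℕ) := by
    push_cast
    rw [mul_comm]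
    gcongr
  exact Nat.floor_le_of_le h

lemma abs_sub_dyadicFloor_succ_le {x : ℝ → ℝ} {ρ K : ℝ} {N : ℕ} (hρ0 : 0 ≤ ρ) (hρ1 : ρ ≤ 1)
    (hK : 0 ≤ K)
    (h : ∀ n k : ℕ, k < N * 2 ^ n → |x ((k + 1 : ℕ) / 2 ^ n) - x (k / 2 ^ n)| ≤ K * ρ ^ n)
    (n : ℕ) {t : ℝ} (ht : t ∈ Icc (0 : ℝ) N) :
    dist (x (dyadicFloor n t)) (x (dyadicFloor (n + 1) t)) ≤ K * ρ ^ n := by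
  set i := ⌊2 ^ n * t⌋₊ with hi
  set j := ⌊2 ^ (n + 1) * t⌋₊ with hj
  have h0 : 0 ≤ 2 ^ n * t := mul_nonneg (by positivity) ht.1
  have hi1 : (i : ℝ) ≤ 2 ^ n * t := Nat.floor_le h0
  have hi2 : 2 ^ n * t < i + 1 := Nat.lt_floor_add_one _
  have hp : (2 : ℝ) ^ (n + 1) * t = 2 * (2 ^ n * t) := by ring
  have hj1 : (j : ℝ) ≤ 2 * (2 ^ n * t) := hp ▸ Nat.floor_le (hp ▸ by linarith)
  have hj2 : 2 * (2 ^ n * t) < j + 1 := hp ▸ Nat.lt_floor_add_one _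
  have hij : dyadicFloor n t = (2 * i : ℕ) / 2 ^ (n + 1) := by
    rw [dyadicFloor, pow_succ]
    push_cast
    field_simp
    rfl
  have hjj : dyadicFloor (n + 1) t = (j : ℝ) / 2 ^ (n + 1) := rfl
  have hl : 2 * i ≤ j := by
    have : 2 * i < j + 1 := by
      have : (2 * i : ℝ) < j + 1 := by linarith
      exact_mod_cast this
    omega
  have hu : j ≤ 2 * i + 1 := by
    have : j < 2 * i + 2 := by
      have : (j : ℝ) < 2 * i + 2 := by linarith
      exact_mod_cast this
    omega
  have hjN : j ≤ N * 2 ^ (n + 1) := floor_le_mul_two_pow (n + 1) ht.2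
  rw [hij, hjj, dist_comm, Real.dist_eq]
  rcases hl.eq_or_lt with he | hlt
  · rw [← he, sub_self, abs_zero]
    positivity
  · have he : j = 2 * i + 1 := by omega
    rw [he]
    refine (h (n + 1) (2 * i) (by omega)).trans ?_
    rw [pow_succ]
    gcongr
    exact mul_le_of_le_one_right (by positivity) hρ1

lemma DyadicIncrementBound.exists_holder {x g : ℝ → ℝ} {γ : ℝ} {N : ℕ} (hγ : 0 < γ)
    (h : DyadicIncrementBound x γ N)
    (hg : ∀ t, g t = limUnder atTop fun n => x (dyadicFloor n t)) :
    ∃ C : ℝ, 0 ≤ C ∧ ∀ s ∈ Icc (0 : ℝ) N, ∀ t ∈ Icc (0 : ℝ) N, |g s - g t| ≤ C * |s - t| ^ γ := by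
  obtain ⟨K, hK, h⟩ := h
  set ρ : ℝ := 2 ^ (-γ) with hρ
  have hρ0 : 0 < ρ := by positivity
  have hρ1 : ρ < 1 := rpow_lt_one_of_one_lt_of_neg one_lt_two (neg_neg_of_pos hγ)
  have h1ρ : 0 < 1 - ρ := sub_pos.2 hρ1
  have hdist : ∀ t ∈ Icc (0 : ℝ) N, ∀ n, |x (dyadicFloor n t) - g t| ≤ K * ρ ^ n / (1 - ρ) := by
    intro t ht n
    have hu := fun n => abs_sub_dyadicFloor_succ_le hρ0.le hρ1.le hK h n ht
    have hl := (cauchySeq_of_le_geometric ρ K hρ1 hu).tendsto_limUnder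
    rw [← hg] at hl
    rw [← Real.dist_eq]
    exact dist_le_of_le_geometric_of_tendsto ρ K hρ1 hu hl n
  set S := ∑ k ∈ Finset.range (N + 1), |x k| with hS
  have hxS : ∀ t ∈ Icc (0 : ℝ) N, |x (dyadicFloor 0 t)| ≤ S := by
    intro t ht
    have h1 : ⌊2 ^ 0 * t⌋₊ ≤ N * 2 ^ 0 := floor_le_mul_two_pow 0 ht.2
    have h2 : dyadicFloor 0 t = (⌊2 ^ 0 * t⌋₊ : ℝ) := by simp [dyadicFloor]
    rw [h2]
    refine Finset.single_le_sum (f := fun k : ℕ => |x k|) (fun _ _ => abs_nonneg _) ?_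
    rw [Finset.mem_range]
    omega
  have hS0 : 0 ≤ S := Finset.sum_nonneg fun _ _ => abs_nonneg _
  set A := 2 * (K / (1 - ρ)) + 2 * S with hA
  set D := (2 * (K / (1 - ρ)) + K) / ρ with hD
  have hA0 : 0 ≤ A := by positivity
  have hD0 : 0 ≤ D := by positivity
  refine ⟨A + D, by positivity, ?_⟩
  intro s hs t ht
  wlog hst : s ≤ t generalizing s t
  · rw [abs_sub_comm, abs_sub_comm s]
    exact this t ht s hs (le_of_not_ge hst)
  rcases hst.eq_or_lt with rfl | hlt
  · simp only [sub_self, abs_zero]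
    positivity
  have htri : ∀ n, |g s - g t| ≤ 2 * (K * ρ ^ n / (1 - ρ)) +
      |x (dyadicFloor n t) - x (dyadicFloor n s)| := by
    intro n
    have e1 := abs_le.1 (hdist s hs n)
    have e2 := abs_le.1 (hdist t ht n)
    have e3 := abs_le.1 (le_refl |x (dyadicFloor n t) - x (dyadicFloor n s)|)
    rw [abs_le]
    constructor <;> linarith [e1.1, e1.2, e2.1, e2.2, e3.1, e3.2]
  rw [abs_sub_comm s, abs_of_pos (sub_pos.2 hlt)]
  rcases le_or_gt (t - s) 1 with h1 | h1
  · obtain ⟨n, hn1, hn2⟩ := exists_nat_pow_near_of_lt_one (sub_pos.2 hlt) h1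
      (y := (1 / 2 : ℝ)) (by norm_num) (by norm_num)
    have hx : |x (dyadicFloor n t) - x (dyadicFloor n s)| ≤ K * ρ ^ n := by
      set i := ⌊2 ^ n * s⌋₊ with hi
      set j := ⌊2 ^ n * t⌋₊ with hj
      have hij : i ≤ j := Nat.floor_le_floor (by gcongr)
      have hji : j ≤ i + 1 := by
        rw [hi, ← Nat.floor_add_one (mul_nonneg (by positivity) hs.1)]
        refine Nat.floor_le_floor ?_
        have : 2 ^ n * (t - s) ≤ 2 ^ n * (1 / 2) ^ n := by gcongr
        rw [← mul_pow] at this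
        norm_num at this
        linarith
      have hjN : j ≤ N * 2 ^ n := floor_le_mul_two_pow n ht.2
      change |x ((j : ℝ) / 2 ^ n) - x ((i : ℝ) / 2 ^ n)| ≤ _
      rcases hij.eq_or_lt with he | hl
      · rw [he, sub_self, abs_zero]
        positivity
      · have he : j = i + 1 := by omega
        rw [he]
        exact h n i (by omega)
    have hpow : ρ ^ n ≤ ρ⁻¹ * (t - s) ^ γ := by
      have e1 : ((1 / 2 : ℝ) ^ (n + 1)) ^ γ ≤ (t - s) ^ γ :=
        rpow_le_rpow (by positivity) hn1.le hγ.le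
      have e2 : ((1 / 2 : ℝ) ^ (n + 1)) ^ γ = ρ ^ (n + 1) := by
        rw [hρ, rpow_neg (by norm_num), ← inv_rpow (by norm_num), ← rpow_natCast, ← rpow_natCast,
          ← rpow_mul (by norm_num), ← rpow_mul (by norm_num), mul_comm, one_div]
      rw [e2, pow_succ] at e1
      rw [inv_mul_eq_div, le_div_iff₀ hρ0]
      exact e1
    calc |g s - g t| ≤ 2 * (K * ρ ^ n / (1 - ρ)) + K * ρ ^ n := (htri n).trans (by gcongr)
      _ = (2 * (K / (1 - ρ)) + K) * ρ ^ n := by ring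
      _ ≤ (2 * (K / (1 - ρ)) + K) * (ρ⁻¹ * (t - s) ^ γ) := by gcongr
      _ = D * (t - s) ^ γ := by rw [hD]; ring
      _ ≤ (A + D) * (t - s) ^ γ := by
        gcongr
        exact le_add_of_nonneg_left hA0
  · have hp1 : 1 ≤ (t - s) ^ γ := one_le_rpow h1.le hγ.le
    have hb : |x (dyadicFloor 0 t) - x (dyadicFloor 0 s)| ≤ 2 * S := by
      refine (abs_sub _ _).trans ?_
      linarith [hxS t ht, hxS s hs]
    calc |g s - g t| ≤ A := by
          have := htri 0
          rw [pow_zero, mul_one] at this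
          linarith
      _ ≤ A + D := by linarith
      _ ≤ (A + D) * (t - s) ^ γ := le_mul_of_one_le_right (by positivity) hp1

lemma ENNReal.le_one_add_of_pow_le {x z : ℝ≥0∞} {p : ℕ} (hp : p ≠ 0) (h : x ^ p ≤ z) :
    x ≤ 1 + z := by
  rcases le_total x 1 with hx | hx
  · exact hx.trans le_self_add
  · exact (le_self_pow₀ hx hp).trans (h.trans le_add_self)

lemma ae_dyadicIncrementBound {Ω : Type*} [MeasurableSpace Ω] {P : Measure Ω}
    {X : ℝ → Ω → ℝ} (hX : ∀ t, Measurable (X t)) {β γ : ℝ} (hγ : γ < β) (N : ℕ)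
    (hmom : ∀ p : ℕ, ∃ A : ℝ, 0 ≤ A ∧ ∀ s ∈ Icc (0 : ℝ) N, ∀ t ∈ Icc (0 : ℝ) N,
      ∫⁻ ω, ‖X t ω - X s ω‖ₑ ^ p ∂P ≤ ENNReal.ofReal (A * (|s - t| ^ β) ^ p)) :
    ∀ᵐ ω ∂P, DyadicIncrementBound (fun t => X t ω) γ N := by
  obtain ⟨p, hp⟩ := exists_nat_gt (1 / (β - γ))
  have hβγ : 0 < β - γ := sub_pos.2 hγ
  have hp0 : p ≠ 0 := by
    rintro rfl
    exact absurd hp (not_lt.2 (by simpa using hβγ.le))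
  have hp1 : 1 < p * (β - γ) := (div_lt_iff₀ hβγ).1 hp
  obtain ⟨A, hA, hmom⟩ := hmom p
  set ρ : ℝ := 2 ^ (-γ) with hρ
  have hρ0 : 0 < ρ := by positivity
  set D : ℕ → ℕ → Ω → ℝ := fun n k ω => X ((k + 1 : ℕ) / 2 ^ n) ω - X (k / 2 ^ n) ω with hD
  have hDm : ∀ n k, Measurable (D n k) := fun n k => (hX _).sub (hX _)
  set Z : Ω → ℝ≥0∞ := fun ω => ∑' n : ℕ, ∑ k ∈ Finset.range (N * 2 ^ n),
    (‖D n k ω‖ₑ * ENNReal.ofReal (ρ⁻¹ ^ n)) ^ p with hZ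
  have hsm : ∀ n k, Measurable fun ω => (‖D n k ω‖ₑ * ENNReal.ofReal (ρ⁻¹ ^ n)) ^ p :=
    fun n k => ((hDm n k).enorm.mul_const _).pow_const p
  have hZm : Measurable Z :=
    Measurable.tsum fun n => Finset.measurable_sum _ fun k _ => hsm n k
  set r : ℝ := 2 * ((2 ^ (-β)) * ρ⁻¹) ^ p with hr
  have hr0 : 0 ≤ r := by positivity
  have hr1 : r < 1 := by
    have : r = 2 ^ (1 - p * (β - γ)) := by
      rw [hr, hρ, ← rpow_neg (by norm_num), ← rpow_add (by norm_num), ← rpow_natCast,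
        ← rpow_mul (by norm_num)]
      nth_rw 1 [← rpow_one 2]
      rw [← rpow_add (by norm_num)]
      congr 1
      ring
    rw [this]
    exact rpow_lt_one_of_one_lt_of_neg one_lt_two (by linarith)
  have hterm : ∀ n k : ℕ, k < N * 2 ^ n →
      ∫⁻ ω, (‖D n k ω‖ₑ * ENNReal.ofReal (ρ⁻¹ ^ n)) ^ p ∂P ≤
        ENNReal.ofReal (A * (((2 ^ (-β)) * ρ⁻¹) ^ p) ^ n) := by
    intro n k hk
    have h2 : (0 : ℝ) < 2 ^ n := by positivity
    have hk1 : ((k + 1 : ℕ) : ℝ) ≤ N * 2 ^ n := by exact_mod_cast hk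
    have hk2 : ((k : ℕ) : ℝ) ≤ N * 2 ^ n := by exact_mod_cast hk.le
    simp_rw [mul_pow]
    rw [lintegral_mul_const _ ((hDm n k).enorm.pow_const p)]
    have hm := hmom (k / 2 ^ n) ⟨by positivity, by rwa [div_le_iff₀ h2]⟩
      ((k + 1 : ℕ) / 2 ^ n) ⟨by positivity, by rwa [div_le_iff₀ h2]⟩
    have hd : |(k : ℝ) / 2 ^ n - (k + 1 : ℕ) / 2 ^ n| = (2 ^ n)⁻¹ := by
      rw [← sub_div, abs_div, abs_of_pos h2]
      simp
    have hpow : ((2 : ℝ) ^ n)⁻¹ ^ β = (2 ^ (-β)) ^ n := by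
      rw [inv_rpow h2.le, rpow_neg (by norm_num), inv_pow, ← rpow_natCast, ← rpow_natCast,
        ← rpow_mul (by norm_num), ← rpow_mul (by norm_num), mul_comm]
    rw [hd, hpow] at hm
    refine (mul_le_mul_left hm _).trans_eq ?_
    rw [← ENNReal.ofReal_pow (by positivity), ← ENNReal.ofReal_mul (by positivity)]
    congr 1
    ring
  have hZint : ∫⁻ ω, Z ω ∂P ≠ ∞ := by
    rw [hZ, lintegral_tsum fun n => (Finset.measurable_sum _ fun k _ => hsm n k).aemeasurable]
    have hs : Summable fun n : ℕ => N * A * r ^ n :=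
      (summable_geometric_of_lt_one hr0 hr1).mul_left _
    refine ne_top_of_le_ne_top hs.tsum_ofReal_ne_top (ENNReal.tsum_le_tsum fun n => ?_)
    rw [lintegral_finsetSum _ fun k _ => hsm n k]
    refine (Finset.sum_le_sum fun k hk => hterm n k (Finset.mem_range.1 hk)).trans_eq ?_
    rw [Finset.sum_const, Finset.card_range, ← ENNReal.ofReal_nsmul, nsmul_eq_mul]
    congr 1
    rw [hr, mul_pow]
    push_cast
    ring
  filter_upwards [ae_lt_top hZm hZint] with ω hω
  refine ⟨1 + (Z ω).toReal, by positivity, fun n k hk => ?_⟩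
  have h1 : (‖D n k ω‖ₑ * ENNReal.ofReal (ρ⁻¹ ^ n)) ^ p ≤ Z ω :=
    (Finset.single_le_sum (f := fun k => (‖D n k ω‖ₑ * ENNReal.ofReal (ρ⁻¹ ^ n)) ^ p)
      (fun _ _ => zero_le) (Finset.mem_range.2 hk)).trans
      (ENNReal.le_tsum (f := fun n => ∑ k ∈ Finset.range (N * 2 ^ n),
        (‖D n k ω‖ₑ * ENNReal.ofReal (ρ⁻¹ ^ n)) ^ p) n)
  have h2 := ENNReal.toReal_mono (ENNReal.add_ne_top.2 ⟨ENNReal.one_ne_top, hω.ne⟩)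
    (ENNReal.le_one_add_of_pow_le hp0 h1)
  rw [ENNReal.toReal_add ENNReal.one_ne_top hω.ne, ENNReal.toReal_one, ENNReal.toReal_mul,
    toReal_enorm, ENNReal.toReal_ofReal (by positivity), inv_pow, ← div_eq_mul_inv,
    div_le_iff₀ (by positivity)] at h2
  exact h2

lemma ae_tendsto_dyadicFloor {Ω : Type*} [MeasurableSpace Ω] {P : Measure Ω}
    {X : ℝ → Ω → ℝ} (hX : ∀ t, Measurable (X t)) {β : ℝ} (hβ : 0 < β) {N : ℕ}
    (hmom : ∃ A : ℝ, 0 ≤ A ∧ ∀ s ∈ Icc (0 : ℝ) N, ∀ t ∈ Icc (0 : ℝ) N,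
      ∫⁻ ω, ‖X t ω - X s ω‖ₑ ∂P ≤ ENNReal.ofReal (A * |s - t| ^ β))
    {t : ℝ} (ht : t ∈ Icc (0 : ℝ) N) :
    ∀ᵐ ω ∂P, Tendsto (fun n => X (dyadicFloor n t) ω) atTop (𝓝 (X t ω)) := by
  obtain ⟨A, hA, hmom⟩ := hmom
  have hm : ∀ n, Measurable fun ω => ‖X (dyadicFloor n t) ω - X t ω‖ₑ :=
    fun n => ((hX _).sub (hX _)).enorm
  set r : ℝ := (1 / 2) ^ β with hr
  have hr1 : r < 1 := rpow_lt_one (by norm_num) (by norm_num) hβ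
  have hint : ∫⁻ ω, ∑' n, ‖X (dyadicFloor n t) ω - X t ω‖ₑ ∂P ≠ ∞ := by
    rw [lintegral_tsum fun n => (hm n).aemeasurable]
    have hs : Summable fun n : ℕ => A * r ^ n :=
      (summable_geometric_of_lt_one (by positivity) hr1).mul_left _
    refine ne_top_of_le_ne_top hs.tsum_ofReal_ne_top (ENNReal.tsum_le_tsum fun n => ?_)
    refine (hmom t ht _ (dyadicFloor_mem_Icc n ht)).trans (ENNReal.ofReal_le_ofReal ?_)
    have e : r ^ n = ((1 / 2 : ℝ) ^ n) ^ β := by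
      rw [hr, ← rpow_natCast, ← rpow_natCast, ← rpow_mul (by norm_num),
        ← rpow_mul (by norm_num), mul_comm]
    rw [e]
    have := abs_sub_dyadicFloor_le n ht.1
    gcongr
  filter_upwards [ae_lt_top (Measurable.tsum hm) hint] with ω hω
  rw [tendsto_iff_edist_tendsto_0]
  simpa only [edist_eq_enorm_sub] using ENNReal.tendsto_atTop_zero_of_tsum_ne_top hω.ne

/-- **Kolmogorov–Chentsov**: a process on `[0, ∞)` all of whose increments have `p`-th moments of
order `|s - t| ^ (β * p)`, locally uniformly and for every `p`, has a modification which is locally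
Hölder continuous with every exponent `γ < β`. -/
theorem exists_locally_holder_modification {Ω : Type*} [MeasurableSpace Ω] {P : Measure Ω}
    {X : ℝ → Ω → ℝ} (hX : ∀ t, Measurable (X t)) {β : ℝ} (hβ : 0 < β)
    (hmom : ∀ N p : ℕ, ∃ A : ℝ, 0 ≤ A ∧ ∀ s ∈ Icc (0 : ℝ) N, ∀ t ∈ Icc (0 : ℝ) N,
      ∫⁻ ω, ‖X t ω - X s ω‖ₑ ^ p ∂P ≤ ENNReal.ofReal (A * (|s - t| ^ β) ^ p)) :
    ∃ G : ℝ → Ω → ℝ, (∀ t, 0 ≤ t → ∀ᵐ ω ∂P, G t ω = X t ω) ∧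
      ∀ ω, ∀ γ : ℝ, 0 < γ → γ < β → ∀ N : ℕ, ∃ C : ℝ, 0 ≤ C ∧
        ∀ s ∈ Icc (0 : ℝ) N, ∀ t ∈ Icc (0 : ℝ) N, |G s ω - G t ω| ≤ C * |s - t| ^ γ := by
  classical
  let good : Ω → Prop := fun ω => ∀ m N : ℕ,
    DyadicIncrementBound (fun t => X t ω) (β - 1 / (m + 1)) N
  have hgood : ∀ᵐ ω ∂P, good ω := by
    refine ae_all_iff.2 fun m => ae_all_iff.2 fun N => ae_dyadicIncrementBound hX ?_ N (hmom N)
    have : (0 : ℝ) < 1 / (m + 1) := by positivity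
    linarith
  refine ⟨fun t ω => if good ω then limUnder atTop fun n => X (dyadicFloor n t) ω else 0, ?_, ?_⟩
  · intro t ht
    obtain ⟨N, hN⟩ := exists_nat_ge t
    have hlim := ae_tendsto_dyadicFloor hX hβ (by simpa using hmom N 1) ⟨ht, hN⟩
    filter_upwards [hgood, hlim] with ω h1 h2
    rw [if_pos h1]
    exact h2.limUnder_eq
  · intro ω γ hγ0 hγ N
    by_cases h : good ω
    · simp only [h, if_true]
      obtain ⟨m, hm⟩ := exists_nat_one_div_lt (sub_pos.2 hγ)
      exact ((h m N).mono (by linarith)).exists_holder (x := fun t => X t ω) hγ0 fun t => rfl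
    · exact ⟨0, le_rfl, fun s _ t _ => by simp [h]⟩

lemma exists_lintegral_enorm_pow_gaussianReal_le (p : ℕ) :
    ∃ m : ℝ, 0 ≤ m ∧ ∀ V b : ℝ, 0 ≤ b → V ≤ b ^ 2 →
      ∫⁻ x, ‖x‖ₑ ^ p ∂(gaussianReal 0 V.toNNReal) ≤ ENNReal.ofReal (m * b ^ p) := by
  have hfin : ∫⁻ z, ‖z‖ₑ ^ p ∂(gaussianReal 0 1) ≠ ∞ := by
    have h := ((memLp_id_gaussianReal (μ := 0) (v := 1) p).integrable_norm_pow' ).2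
    simpa [HasFiniteIntegral, enorm_pow] using h.ne
  refine ⟨(∫⁻ z, ‖z‖ₑ ^ p ∂(gaussianReal 0 1)).toReal, ENNReal.toReal_nonneg, fun V b hb hV => ?_⟩
  have hV' : V.toNNReal = (max V 0).toNNReal := NNReal.eq (by simp [Real.coe_toNNReal'])
  rw [hV', ← map_gaussianReal_affine 0 (le_max_right V 0),
    lintegral_map (by fun_prop) (by fun_prop)]
  simp only [zero_add, enorm_mul, mul_pow]
  rw [lintegral_const_mul _ (by fun_prop), mul_comm, ENNReal.ofReal_mul ENNReal.toReal_nonneg,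
    ENNReal.ofReal_toReal hfin, ENNReal.ofReal_pow hb,
    Real.enorm_of_nonneg (sqrt_nonneg _)]
  gcongr
  exact Real.sqrt_le_iff.2 ⟨hb, max_le hV (sq_nonneg b)⟩

lemma SchwartzMap.exists_abs_le (f : SchwartzMap ℝ ℝ) : ∃ M : ℝ, 0 ≤ M ∧ ∀ x, |f x| ≤ M :=
  ⟨SchwartzMap.seminorm ℝ 0 0 f, apply_nonneg _ _, fun x => f.norm_le_seminorm ℝ x⟩

lemma SchwartzMap.exists_abs_sub_le (f : SchwartzMap ℝ ℝ) :
    ∃ L : ℝ, 0 < L ∧ ∀ x y, |f x - f y| ≤ L * |x - y| := by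
  obtain ⟨L, hL0, hL⟩ := (SchwartzMap.derivCLM ℝ ℝ f).exists_abs_le
  refine ⟨L + 1, by positivity, fun x y => ?_⟩
  have h := convex_univ.norm_image_sub_le_of_norm_deriv_le (f := f) (C := L) (x := y) (y := x)
    (fun z _ => f.differentiableAt) (fun z _ => hL z) (mem_univ _) (mem_univ _)
  refine h.trans ?_
  rw [Real.norm_eq_abs]
  gcongr
  linarith

lemma continuous_udens {f : ℝ → ℝ} (hf : Continuous f) {M L : ℝ} (hM : ∀ x, |f x| ≤ M)
    (hL0 : 0 ≤ L) (hL : ∀ x y, |f x - f y| ≤ L * |x - y|) {t : ℝ} (ht : 0 ≤ t) :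
    Continuous fun x => udens f x t :=
  (LipschitzWith.of_dist_le_mul (K := L.toNNReal) fun x y => by
    simpa [Real.dist_eq, hL0] using abs_udens_sub_le hf hM hL0 hL x y ht ht).continuous

lemma integrableOn_Iic_of_setIntegral_ne_zero {u : ℝ → ℝ} (hu : Continuous u) {b : ℝ}
    (h : ∫ x in Iic b, u x ≠ 0) (a : ℝ) : IntegrableOn u (Iic a) := by
  have hb : IntegrableOn u (Iic b) := by
    by_contra hcon
    exact h (integral_undef hcon)
  refine (hb.union (hu.integrableOn_Icc (a := b) (b := a))).mono_set fun x hx => ?_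
  rcases le_total x b with h' | h'
  · exact Or.inl h'
  · exact Or.inr ⟨h', hx⟩

lemma abs_cdf_sub_le {Ω : Type*} [MeasurableSpace Ω] {P : Measure Ω} [IsProbabilityMeasure P]
    {B : ℝ → Ω → ℝ} {K : ℝ}
    (hcross : ∀ s t, 0 ≤ s → s < t → ∀ a,
      P.real {ω | B s ω ≤ a} - P.real {ω | B s ω ≤ a ∧ B t ω ≤ a} ≤ K * √|s - t| ∧
      P.real {ω | B t ω ≤ a} - P.real {ω | B s ω ≤ a ∧ B t ω ≤ a} ≤ K * √|s - t|)
    {s t : ℝ} (hs : 0 ≤ s) (ht : 0 ≤ t) (a : ℝ) :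
    |P.real {ω | B s ω ≤ a} - P.real {ω | B t ω ≤ a}| ≤ K * √|s - t| := by
  wlog hst : s ≤ t generalizing s t
  · rw [abs_sub_comm, abs_sub_comm s]
    exact this ht hs (le_of_not_ge hst)
  rcases hst.eq_or_lt with rfl | hlt
  · simp
  obtain ⟨h1, h2⟩ := hcross s t hs hlt a
  have h3 : P.real {ω | B s ω ≤ a ∧ B t ω ≤ a} ≤ P.real {ω | B s ω ≤ a} :=
    measureReal_mono fun ω hω => hω.1
  have h4 : P.real {ω | B s ω ≤ a ∧ B t ω ≤ a} ≤ P.real {ω | B t ω ≤ a} :=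
    measureReal_mono fun ω hω => hω.2
  rw [abs_le]
  constructor <;> linarith

lemma sub_joint_le {Ω : Type*} [MeasurableSpace Ω] {P : Measure Ω} [IsProbabilityMeasure P]
    {B : ℝ → Ω → ℝ} {K α : ℝ} {q : ℝ → ℝ}
    (hα : ∀ t, 0 ≤ t → P.real {ω | B t ω ≤ q t} = α)
    (hcross : ∀ s t, 0 ≤ s → s < t → ∀ a,
      P.real {ω | B s ω ≤ a} - P.real {ω | B s ω ≤ a ∧ B t ω ≤ a} ≤ K * √|s - t| ∧
      P.real {ω | B t ω ≤ a} - P.real {ω | B s ω ≤ a ∧ B t ω ≤ a} ≤ K * √|s - t|)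
    {s t : ℝ} (hs : 0 ≤ s) (ht : 0 ≤ t) :
    α - P.real {ω | B s ω ≤ q s ∧ B t ω ≤ q t} ≤ K * √|s - t| := by
  wlog hst : s ≤ t generalizing s t
  · have hc : {ω | B s ω ≤ q s ∧ B t ω ≤ q t} = {ω | B t ω ≤ q t ∧ B s ω ≤ q s} := by
      ext ω
      exact and_comm
    rw [hc, abs_sub_comm s]
    exact this ht hs (le_of_not_ge hst)
  rcases hst.eq_or_lt with rfl | hlt
  · simp [hα s hs]
  rcases le_total (q s) (q t) with h | h
  · have h1 := (hcross s t hs hlt (q s)).1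
    have h2 : P.real {ω | B s ω ≤ q s ∧ B t ω ≤ q s} ≤ P.real {ω | B s ω ≤ q s ∧ B t ω ≤ q t} :=
      measureReal_mono fun ω hω => ⟨hω.1, hω.2.trans h⟩
    rw [hα s hs] at h1
    linarith
  · have h1 := (hcross s t hs hlt (q t)).2
    have h2 : P.real {ω | B s ω ≤ q t ∧ B t ω ≤ q t} ≤ P.real {ω | B s ω ≤ q s ∧ B t ω ≤ q t} :=
      measureReal_mono fun ω hω => ⟨hω.1.trans h, hω.2⟩
    rw [hα t ht] at h1
    linarith

lemma exists_moment_bound_of_variance_bound {Ω : Type*} [MeasurableSpace Ω] {P : Measure Ω}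
    {F : ℝ → Ω → ℝ} (hF : ∀ t, Measurable (F t)) {V : ℝ → ℝ → ℝ} {S : Set ℝ}
    (hlaw : ∀ s ∈ S, ∀ t ∈ S, P.map (fun ω => F t ω - F s ω) = gaussianReal 0 (V s t).toNNReal)
    {A : ℝ} (hA : 0 ≤ A) (hV : ∀ s ∈ S, ∀ t ∈ S, V s t ≤ A * √|s - t|) (p : ℕ) :
    ∃ A' : ℝ, 0 ≤ A' ∧ ∀ s ∈ S, ∀ t ∈ S,
      ∫⁻ ω, ‖F t ω - F s ω‖ₑ ^ p ∂P ≤ ENNReal.ofReal (A' * (|s - t| ^ (1 / 4 : ℝ)) ^ p) := by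
  obtain ⟨m, hm, hmom⟩ := exists_lintegral_enorm_pow_gaussianReal_le p
  refine ⟨m * √A ^ p, by positivity, fun s hs t ht => ?_⟩
  have hsq : (√A * |s - t| ^ (1 / 4 : ℝ)) ^ 2 = A * √|s - t| := by
    rw [mul_pow, Real.sq_sqrt hA, Real.sqrt_eq_rpow, ← rpow_natCast, ← rpow_mul (abs_nonneg _)]
    norm_num
  have h := hmom (V s t) (√A * |s - t| ^ (1 / 4 : ℝ)) (by positivity) (hsq ▸ hV s hs t ht)
  rw [← hlaw s hs t ht,
    lintegral_map (g := fun ω => F t ω - F s ω) (by fun_prop) ((hF t).sub (hF s))] at h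
  refine h.trans_eq ?_
  rw [mul_pow, mul_assoc]

lemma holderOnWith_of_abs_sub_le {g : ℝ → ℝ} {S : Set ℝ} {C : ℝ} (hC : 0 ≤ C) {γ : ℝ≥0}
    (h : ∀ s ∈ S, ∀ t ∈ S, |g s - g t| ≤ C * |s - t| ^ (γ : ℝ)) :
    HolderOnWith C.toNNReal γ g S := by
  intro s hs t ht
  rw [edist_dist, edist_dist, ENNReal.ofReal_rpow_of_nonneg dist_nonneg (NNReal.coe_nonneg γ)]
  change _ ≤ ENNReal.ofReal C * _
  rw [← ENNReal.ofReal_mul hC]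
  exact ENNReal.ofReal_le_ofReal (h s hs t ht)

end

/-- Any centered Gaussian process `F` on `[0,∞)` with covariance `ρ` has a
modification which is locally Hölder continuous on `[0,∞)` with exponent `γ` for every
`γ < 1/4`. -/
theorem holder_modification
    {Ω : Type*} [MeasurableSpace Ω] (P : Measure Ω) [IsProbabilityMeasure P]
    (f : SchwartzMap ℝ ℝ) (hf_nonneg : ∀ x, 0 ≤ f x) (hf_prob : ∫ x : ℝ, f x = 1)
    (α : ℝ) (hα : α ∈ Set.Ioo (0 : ℝ) 1)
    (q : ℝ → ℝ)
    (hq : ∀ t, 0 ≤ t → ∫ x in Set.Iic (q t), udens (⇑f) x t = α)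
    (hq_unique : ∀ t, 0 ≤ t → ∀ r : ℝ, (∫ x in Set.Iic r, udens (⇑f) x t = α) → r = q t)
    (hfq0 : 0 < f (q 0))
    (B : ℝ → Ω → ℝ) (hB_meas : ∀ t, Measurable (B t))
    (hBmarg : ∀ t, 0 ≤ t → ∀ a : ℝ,
      (P {ω | B t ω ≤ a}).toReal = ∫ x in Set.Iic a, udens (⇑f) x t)
    (hBjoint : ∀ s t : ℝ, 0 ≤ s → s < t → ∀ a b : ℝ,
      (P {ω | B s ω ≤ a ∧ B t ω ≤ b}).toReal
        = ∫ x in Set.Iic a, (∫ y in Set.Iic b, heatKernel (t - s) x y) * udens (⇑f) x s)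
    {Ω' : Type*} [MeasurableSpace Ω'] (P' : Measure Ω') [IsProbabilityMeasure P']
    (F : ℝ → Ω' → ℝ) (hF_meas : ∀ t, Measurable (F t))
    (hFgauss : ∀ (d : ℕ) (ts : Fin d → ℝ), (∀ i, 0 ≤ ts i) → ∀ c : Fin d → ℝ,
      Measure.map (fun ω => ∑ i, c i * F (ts i) ω) P'
        = ProbabilityTheory.gaussianReal 0
            (Real.toNNReal (∑ i, ∑ j, c i * c j * rho P B (⇑f) q α (ts i) (ts j)))) :
    ∃ G : ℝ → Ω' → ℝ,
      (∀ t, 0 ≤ t → ∀ᵐ ω ∂P', G t ω = F t ω) ∧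
      ∀ ω : Ω', ∀ γ : NNReal, 0 < γ → (γ : ℝ) < 1 / 4 → ∀ T : ℝ, 0 < T →
        ∃ C : NNReal, HolderOnWith C γ (fun t => G t ω) (Set.Icc 0 T) := by
  have hfc : Continuous f := f.continuous
  obtain ⟨M, -, hM⟩ := f.exists_abs_le
  obtain ⟨L, hL0, hL⟩ := f.exists_abs_sub_le
  have hM0 : 0 < M := hfq0.trans_le ((le_abs_self _).trans (hM _))
  have hui : ∀ t, 0 ≤ t → ∀ a, IntegrableOn (fun x => udens f x t) (Iic a) := fun t ht =>
    integrableOn_Iic_of_setIntegral_ne_zero (continuous_udens hfc hM hL0.le hL ht)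
      (by rw [hq t ht]; exact hα.1.ne')
  set K := M * √(2 * π) with hK
  have hK0 : 0 < K := by positivity
  have hcross : ∀ s t, 0 ≤ s → s < t → ∀ a,
      P.real {ω | B s ω ≤ a} - P.real {ω | B s ω ≤ a ∧ B t ω ≤ a} ≤ K * √|s - t| ∧
      P.real {ω | B t ω ≤ a} - P.real {ω | B s ω ≤ a ∧ B t ω ≤ a} ≤ K * √|s - t| := by
    intro s t hs hst a
    have h := crossing_le (sub_pos.2 hst) (fun x => udens_nonneg hf_nonneg x s)
      (fun x => udens_le hfc hM x hs) (hui s hs) (hBmarg s hs) (hBjoint s t hs hst) a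
    rwa [Real.sqrt_mul (by positivity), ← mul_assoc, ← abs_of_pos (sub_pos.2 hst),
      abs_sub_comm] at h
  have hαq : ∀ t, 0 ≤ t → P.real {ω | B t ω ≤ q t} = α := fun t ht =>
    (hBmarg t ht (q t)).trans (hq t ht)
  set g : ℝ → ℝ := fun t => udens f (q t) t with hg
  have hg0 : ∀ t, 0 ≤ t → 0 < g t := by
    intro t ht
    rcases ht.eq_or_lt with rfl | ht'
    · simpa [hg, udens] using hfq0
    · exact udens_pos hfc hf_nonneg hM ⟨_, hfq0.ne'⟩ _ ht'
  have hqb : ∀ s t, 0 ≤ s → 0 ≤ t → ∀ r, 0 ≤ r → r ≤ |q t - q s| →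
      r * (g s - L * √|s - t| - L * r) ≤ K * √|s - t| := by
    intro s t hs ht r hr0 hr
    have h1 := mul_le_abs_setIntegral_Iic_sub (v := fun x => udens f x t) (a := q s) (b := q t)
      (c := g s - L * √|s - t|) (fun x => udens_nonneg hf_nonneg x t) (hui t ht) hL0.le
      (fun x => by
        have := (abs_le.1 (abs_udens_sub_le hfc hM hL0.le hL (q s) x hs ht)).2
        rw [abs_sub_comm (q s)] at this
        simp only [hg]
        linarith) hr0 hr
    have h2 := abs_cdf_sub_le hcross hs ht (q s)
    rw [hαq s hs] at h2
    rw [hq t ht, ← hBmarg t ht] at h1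
    exact h1.trans h2
  have hgq : ∀ s t, 0 ≤ s → 0 ≤ t → |g s - g t| ≤ L * (|q s - q t| + √|s - t|) :=
    fun s t hs ht => abs_udens_sub_le hfc hM hL0.le hL (q s) (q t) hs ht
  have hlaw : ∀ s, 0 ≤ s → ∀ t, 0 ≤ t → P'.map (fun ω => F t ω - F s ω) =
      ProbabilityTheory.gaussianReal 0 (rho P B f q α s s + rho P B f q α t t
        - 2 * rho P B f q α s t).toNNReal := by
    intro s hs t ht
    have h := hFgauss 2 ![s, t] (by simp [Fin.forall_fin_two, hs, ht]) ![-1, 1]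
    have hsymm : rho P B f q α t s = rho P B f q α s t := by
      simp only [rho, and_comm, mul_comm]
    simp only [Fin.sum_univ_two, Matrix.cons_val_zero, Matrix.cons_val_one, hsymm] at h
    convert h using 2
    · ext ω
      ring
    · congr 1
      ring
  have hmom : ∀ N p : ℕ, ∃ A : ℝ, 0 ≤ A ∧ ∀ s ∈ Icc (0 : ℝ) N, ∀ t ∈ Icc (0 : ℝ) N,
      ∫⁻ ω, ‖F t ω - F s ω‖ₑ ^ p ∂P' ≤ ENNReal.ofReal (A * (|s - t| ^ (1 / 4 : ℝ)) ^ p) := by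
    intro N p
    obtain ⟨c, C, hc, hC, hcg, hgC⟩ := exists_holder_of_quantile_bound hL0 hK0 hg0
      (fun t ht => udens_le hfc hM (q t) ht) hqb hgq (Nat.cast_nonneg N)
    refine exists_moment_bound_of_variance_bound hF_meas
      (fun s hs t ht => hlaw s hs.1 t ht.1)
      (A := C ^ 2 * √N / c ^ 4 + 2 * K / c ^ 2) (by positivity) ?_ p
    intro s hs t ht
    have hrho : ∀ r, 0 ≤ r → rho P B f q α r r = (α - α ^ 2) / (g r * g r) := by
      intro r hr
      have := hαq r hr
      rw [measureReal_def] at this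
      simp only [rho, and_self, this, hg]
    rw [hrho s hs.1, hrho t ht.1]
    refine increment_variance_le hα hc (hcg s hs) (hcg t ht) hK0.le
      (sub_joint_le hαq hcross hs.1 ht.1) (hgC s hs t ht) (sqrt_nonneg _) (sqrt_le_sqrt ?_)
    exact abs_sub_le_of_nonneg_of_le hs.1 hs.2 ht.1 ht.2
  obtain ⟨G, hGF, hG⟩ := exists_locally_holder_modification hF_meas (by norm_num) hmom
  refine ⟨G, hGF, fun ω γ hγ0 hγ T _ => ?_⟩
  obtain ⟨C, hC, h⟩ := hG ω γ hγ0 hγ ⌈T⌉₊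
  have hsub : Icc 0 T ⊆ Icc (0 : ℝ) ⌈T⌉₊ := Icc_subset_Icc_right (Nat.le_ceil T)
  exact ⟨C.toNNReal, holderOnWith_of_abs_sub_le hC fun s hs t ht => h s (hsub hs) t (hsub ht)⟩
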